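/- arXiv:2304.06450 — 2 statements merged into one kernel-verified Lean document; each statement's English description precedes it below -/
import Mathlib

section
/- Let D₀ ◁ D₁ ◁ D₂ be strong extensions of partial K-powered fields. Then for every finite tuple a in D₁, the powers-transcendence degree of a over D₀ computed in D₁ equals that computed in D₂: K-td^{D₁}(a/D₀) = K-td^{D₂}(a/D₀). -/
open Set Submodule

/-- Relative linear dimension: the dimension of the span of `A ∪ B` modulo the span of `B`. -/
noncomputable def ldim (R : Type*) [DivisionRing R] {V : Type*} [AddCommGroup V] [Module R V]
    (A B : Set V) : ℕ :=
  Module.finrank R (↥(span R (A ∪ B)) ⧸ (span R B).comap (span R (A ∪ B)).subtype)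

/-- Relative transcendence degree of `A` over (the field generated by) `B`. -/
noncomputable def td {F : Type*} [Field F] [CharZero F] (A B : Set F) : ℕ :=
  sSup {n : ℕ | ∃ s : Fin n → F, (∀ i, s i ∈ A) ∧
    AlgebraicIndependent (Algebra.adjoin ℚ B) s}

/-- A partial K-powered field: a ℚ-subspace `D` of a `K`-vector space `V` together with a
partial exponential group homomorphism into `Fˣ`, such that `D` `K`-spans `V` and
`exp(D)` generates `F` as a field. -/
structure PPF (K : Type) [Field K] [CharZero K] where
  V : Type
  F : Type
  [addV : AddCommGroup V]
  [modK : Module K V]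
  [modQ : Module ℚ V]
  [fieldF : Field F]
  [charF : CharZero F]
  D : Submodule ℚ V
  exp : V → F
  exp_ne_zero : ∀ x ∈ D, exp x ≠ 0
  exp_add : ∀ x ∈ D, ∀ y ∈ D, exp (x + y) = exp x * exp y
  spans : span K (D : Set V) = ⊤
  generates : Subfield.closure (exp '' D) = ⊤

attribute [instance] PPF.addV PPF.modK PPF.modQ PPF.fieldF PPF.charF

variable {K : Type} [Field K] [CharZero K]

/-- The predimension δ(A/B) = ldim_K(A/B) + td(exp A / exp B) − ldim_ℚ(A/B). -/
noncomputable def PPF.delta (P : PPF K) (A B : Set P.V) : ℤ :=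
  (ldim K A B : ℤ) + (td (P.exp '' A) (P.exp '' B) : ℤ) - (ldim ℚ A B : ℤ)

/-- A subset is strong in `P` if every finite tuple from the domain `D` has
nonnegative predimension over it. -/
def PPF.StrongIn (P : PPF K) (S : Set P.V) : Prop :=
  ∀ (n : ℕ) (z : Fin n → P.V), (∀ i, z i ∈ P.D) → 0 ≤ P.delta (Set.range z) S

/-- A strong extension `D₀ ◁ D₁` of sub-partial-K-powered fields of `P`:
kernel-preserving, and every finite tuple from `D₁` has nonnegative predimension over `D₀`. -/
def PPF.StrongExt (P : PPF K) (D₀ D₁ : Submodule ℚ P.V) : Prop :=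
  D₀ ≤ D₁ ∧ D₁ ≤ P.D ∧ (∀ x ∈ D₁, P.exp x = 1 → x ∈ D₀) ∧
    ∀ (n : ℕ) (z : Fin n → P.V), (∀ i, z i ∈ D₁) → 0 ≤ P.delta (Set.range z) (D₀ : Set P.V)

/-- The K-powers closure of `A` inside the sub-powered-field `E` of `P`. -/
def PPF.pclIn (P : PPF K) (E : Submodule ℚ P.V) (A : Set P.V) : Submodule ℚ P.V :=
  sInf {S | A ⊆ S ∧ S ≤ E ∧ ∀ (n : ℕ) (z : Fin n → P.V), (∀ i, z i ∈ E) →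
      P.delta (Set.range z) (S : Set P.V) ≤ 0 → ∀ i, z i ∈ S}

/-- Powers-transcendence degree of `A` over `B`, computed in the sub-powered-field `E` of `P`:
the least size of a tuple from `E` whose adjunction to `B` captures `A` in the closure. -/
noncomputable def PPF.ktdIn (P : PPF K) (E : Submodule ℚ P.V) (A B : Set P.V) : ℕ :=
  sInf {m | ∃ s : Fin m → P.V, (∀ i, s i ∈ E) ∧ A ⊆ P.pclIn E (B ∪ Set.range s)}

/-- `S` is a purely powers-transcendental extension of `D₀` inside `P`: every finite tuple
from `S` not entirely contained in `D₀` has strictly positive predimension over `D₀`. -/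
def PPF.PPT (P : PPF K) (D₀ S : Submodule ℚ P.V) : Prop :=
  D₀ ≤ S ∧ ∀ (n : ℕ) (z : Fin n → P.V), (∀ i, z i ∈ S) → (∃ i, z i ∉ D₀) →
    0 < P.delta (Set.range z) (D₀ : Set P.V)

/-- The subfield of `F` generated by the exponentials of `S`. -/
def PPF.fieldOf (P : PPF K) (S : Submodule ℚ P.V) : Subfield P.F :=
  Subfield.closure (P.exp '' S)

/-- The sub-powered-field `S` of `P` is full: exp maps `S` onto the nonzero elements of its
field, and its field is (relatively) algebraically closed. -/
def PPF.FullSub (P : PPF K) (S : Submodule ℚ P.V) : Prop :=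
  S ≤ P.D ∧ (∀ y ∈ P.fieldOf S, y ≠ 0 → ∃ x ∈ S, P.exp x = y) ∧
    ∀ y : P.F, (∃ p : Polynomial P.F, p ≠ 0 ∧ (∀ i, p.coeff i ∈ P.fieldOf S) ∧
      Polynomial.eval y p = 0) → y ∈ P.fieldOf S

/-- `(eV, eF)` is an isomorphism, over the base `D₀`, between the sub-partial-K-powered fields
of `P` generated by `D₂` and `D₃`: `eV` is a `K`-linear bijection of the vector-space parts
mapping `D₂` onto `D₃` and fixing `D₀`, `eF` is a field isomorphism of the field parts fixing
the field of `D₀`, and the pair commutes with exp. -/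
def PPF.IsIsoOver (P : PPF K) (D₂ D₃ D₀ : Submodule ℚ P.V)
    (eV : P.V → P.V) (eF : P.F → P.F) : Prop :=
  Set.BijOn eV (span K (D₂ : Set P.V) : Set P.V) (span K (D₃ : Set P.V)) ∧
  Set.BijOn eV (D₂ : Set P.V) (D₃ : Set P.V) ∧
  (∀ x y : P.V, x ∈ span K (D₂ : Set P.V) → y ∈ span K (D₂ : Set P.V) →
    eV (x + y) = eV x + eV y) ∧
  (∀ (c : K) (x : P.V), x ∈ span K (D₂ : Set P.V) → eV (c • x) = c • eV x) ∧
  (∀ x ∈ D₀, eV x = x) ∧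
  Set.BijOn eF (P.fieldOf D₂ : Set P.F) (P.fieldOf D₃ : Set P.F) ∧
  (∀ x y : P.F, x ∈ P.fieldOf D₂ → y ∈ P.fieldOf D₂ → eF (x + y) = eF x + eF y) ∧
  (∀ x y : P.F, x ∈ P.fieldOf D₂ → y ∈ P.fieldOf D₂ → eF (x * y) = eF x * eF y) ∧
  (∀ x ∈ D₀, eF (P.exp x) = P.exp x) ∧
  (∀ x ∈ D₂, eF (P.exp x) = P.exp (eV x))

/-! ### Abstract relative ranks -/

/-- A relative rank function `r` governed by a closure operator `cl`. -/
structure IsRk {V : Type*} (r : Set V → Set V → ℕ) (cl : Set V → Set V) : Prop where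
  empty : ∀ B, r ∅ B = 0
  step0 : ∀ (z B : Set V) (x : V), z.Finite → x ∈ cl B → r (insert x z) B = r z (insert x B)
  step1 : ∀ (z B : Set V) (x : V), z.Finite → x ∉ cl B →
    r (insert x z) B = r z (insert x B) + 1
  mono : ∀ B B' : Set V, B ⊆ B' → cl B ⊆ cl B'
  fin : ∀ (B : Set V) (x : V), x ∈ cl B → ∃ w : Set V, w.Finite ∧ w ⊆ B ∧ x ∈ cl w

namespace IsRk

variable {V : Type*} {r : Set V → Set V → ℕ} {cl : Set V → Set V}

theorem singleton0 (h : IsRk r cl) {x : V} {B : Set V} (hx : x ∈ cl B) : r {x} B = 0 := by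
  have := h.step0 ∅ B x finite_empty hx
  rw [h.empty] at this
  simpa using this

theorem singleton1 (h : IsRk r cl) {x : V} {B : Set V} (hx : x ∉ cl B) : r {x} B = 1 := by
  have := h.step1 ∅ B x finite_empty hx
  rw [h.empty] at this
  simpa using this

theorem singleton_le (h : IsRk r cl) (x : V) (B : Set V) : r {x} B ≤ 1 := by
  by_cases hx : x ∈ cl B
  · rw [h.singleton0 hx]; omega
  · rw [h.singleton1 hx]

theorem step (h : IsRk r cl) {z : Set V} (hz : z.Finite) (x : V) (B : Set V) :
    r (insert x z) B = r {x} B + r z (insert x B) := by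
  by_cases hx : x ∈ cl B
  · rw [h.singleton0 hx, h.step0 z B x hz hx, zero_add]
  · rw [h.singleton1 hx, h.step1 z B x hz hx, add_comm]

theorem add (h : IsRk r cl) {z z' : Set V} (hz : z.Finite) (hz' : z'.Finite) (B : Set V) :
    r (z ∪ z') B = r z' B + r z (B ∪ z') := by
  induction z', hz' using Set.Finite.induction_on generalizing B with
  | empty => simp [h.empty]
  | @insert x t hx ht ih =>
    rw [Set.union_insert, h.step (hz.union ht), ih, h.step ht, Set.insert_union, Set.union_insert,
      add_assoc]

theorem anti (h : IsRk r cl) {z : Set V} (hz : z.Finite) {B B' : Set V} (hB : B ⊆ B') :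
    r z B' ≤ r z B := by
  induction z, hz using Set.Finite.induction_on generalizing B B' with
  | empty => simp [h.empty]
  | @insert x t hx ht ih =>
    have := ih (Set.insert_subset_insert (a := x) hB)
    rw [h.step ht, h.step ht]
    refine add_le_add ?_ this
    by_cases hx : x ∈ cl B
    · rw [h.singleton0 (h.mono _ _ hB hx)]; omega
    · rw [h.singleton1 hx]; exact h.singleton_le _ _

theorem eq_zero (h : IsRk r cl) {z : Set V} (hz : z.Finite) {B : Set V} (hB : z ⊆ cl B) :
    r z B = 0 := by
  induction z, hz using Set.Finite.induction_on generalizing B with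
  | empty => simp [h.empty]
  | @insert x t hx ht ih =>
    rw [h.step0 _ _ _ ht (hB (Set.mem_insert _ _))]
    exact ih (((Set.subset_insert _ _).trans hB).trans (h.mono _ _ (Set.subset_insert _ _)))

theorem finchar (h : IsRk r cl) {z : Set V} (hz : z.Finite) (B S : Set V) :
    ∃ w : Set V, w.Finite ∧ w ⊆ S ∧ r z (B ∪ w) ≤ r z (B ∪ S) := by
  induction z, hz using Set.Finite.induction_on generalizing B with
  | empty => exact ⟨∅, finite_empty, Set.empty_subset _, by simp [h.empty]⟩
  | @insert x t hx ht ih =>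
    obtain ⟨w, hw, hwS, hle⟩ := ih (insert x B)
    by_cases hc : x ∈ cl (B ∪ S)
    · obtain ⟨u, hu, huS, hxu⟩ := h.fin _ _ hc
      refine ⟨w ∪ (u ∩ S), hw.union (hu.inter_of_left _), Set.union_subset hwS Set.inter_subset_right, ?_⟩
      rw [h.step0 _ _ _ ht hc, h.step0 _ _ _ ht, ← Set.insert_union, ← Set.insert_union]
      · refine le_trans (h.anti ht ?_) hle
        exact Set.union_subset_union_right _ Set.subset_union_left
      · refine h.mono _ _ ?_ hxu
        intro y hy
        rcases huS hy with h1 | h1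
        · exact Or.inl h1
        · exact Or.inr (Or.inr ⟨hy, h1⟩)
    · refine ⟨w, hw, hwS, ?_⟩
      have hc' : x ∉ cl (B ∪ w) := fun h' => hc (h.mono _ _ (Set.union_subset_union_right _ hwS) h')
      rw [h.step1 _ _ _ ht hc, h.step1 _ _ _ ht hc', ← Set.insert_union, ← Set.insert_union]
      omega

theorem congr_base (h : IsRk r cl) {z : Set V} (hz : z.Finite) {B B' : Set V} (hB : B ⊆ B')
    (hB' : B' ⊆ cl B) : r z B' = r z B := by
  refine le_antisymm (h.anti hz hB) ?_
  obtain ⟨w, hw, hwS, hle⟩ := h.finchar hz B B'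
  rw [Set.union_eq_self_of_subset_left hB] at hle
  have h1 := h.add hz hw B
  have h2 := h.add hw hz B
  rw [Set.union_comm, h.eq_zero hw (hwS.trans hB')] at h1
  omega

end IsRk

/-! ### Linear dimension -/

theorem ldim_isRk (R : Type*) [DivisionRing R] (V : Type*) [AddCommGroup V] [Module R V] :
    IsRk (V := V) (ldim R) (fun B => (span R B : Set V)) := by
  have key : ∀ (z B : Set V) (x : V), z.Finite →
      ldim R (insert x z) B = ldim R z (insert x B) +
        Module.finrank R (span R {(span R B).mkQ x}) := by
    intro z B x hz
    unfold ldim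
    have e1 : insert x z ∪ B = z ∪ insert x B := by
      rw [Set.insert_union, Set.union_insert]
    rw [e1]
    set Z := span R (z ∪ insert x B) with hZ
    have hxZ : x ∈ Z := subset_span (Or.inr (Set.mem_insert _ _))
    have hBZ : span R B ≤ Z := span_mono (fun y hy => Or.inr (Set.mem_insert_of_mem _ hy))
    have hYZ : span R (insert x B) ≤ Z := span_mono (fun y hy => Or.inr hy)
    set X' := (span R B).comap Z.subtype with hX'
    set Y' := (span R (insert x B)).comap Z.subtype with hY'
    have hXY : X' ≤ Y' := comap_mono (span_mono (Set.subset_insert _ _))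
    have hfd : Module.Finite R (Z ⧸ X') := by
      have hfin : (insert x z).Finite := hz.insert x
      have : (⊤ : Submodule R (Z ⧸ X')) = span R (X'.mkQ '' (Z.subtype ⁻¹' (insert x z))) := by
        rw [eq_comm, eq_top_iff, ← Submodule.map_span]
        rintro q -
        obtain ⟨⟨v, hv⟩, rfl⟩ := X'.mkQ_surjective q
        have hv' := hv
        rw [hZ, ← e1, span_union, mem_sup] at hv'
        obtain ⟨a, ha, b, hb, rfl⟩ := hv'
        have haZ : a ∈ Z := by
          rw [hZ, ← e1]; exact span_mono Set.subset_union_left ha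
        refine ⟨⟨a, haZ⟩, ?_, ?_⟩
        · have : span R (Subtype.val '' (Z.subtype ⁻¹' (insert x z))) = span R (insert x z) := by
            congr 1
            ext y
            constructor
            · rintro ⟨y, hy, rfl⟩; exact hy
            · intro hy
              refine ⟨⟨y, ?_⟩, hy, rfl⟩
              rw [hZ, ← e1]; exact subset_span (Or.inl hy)
          have h2 : a ∈ (span R (Z.subtype ⁻¹' (insert x z))).map Z.subtype := by
            rw [Submodule.map_span]
            exact this ▸ ha
          obtain ⟨a', ha', h3⟩ := h2
          have : a' = ⟨a, haZ⟩ := Subtype.ext h3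
          rw [← this]; exact ha'
        · rw [mkQ_apply, mkQ_apply, Submodule.Quotient.eq]
          show a - (a + b) ∈ span R B
          simpa using hb
      refine ⟨?_⟩
      rw [this]
      refine fg_span (Set.Finite.image _ ?_)
      exact hfin.preimage (Subtype.val_injective.injOn)
    have h1 := Submodule.finrank_quotient_add_finrank (Y'.map X'.mkQ)
    rw [(quotientQuotientEquivQuotient X' Y' hXY).finrank_eq] at h1
    rw [← h1]
    congr 1
    let f : (Z ⧸ X') →ₗ[R] (V ⧸ span R B) := mapQ X' (span R B) Z.subtype le_rfl
    have hf : Function.Injective f := by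
      rw [← LinearMap.ker_eq_bot, ker_mapQ, ← hX', mkQ_map_self]
    have h2 : (Y'.map X'.mkQ).map f = span R {(span R B).mkQ x} := by
      rw [← Submodule.map_comp, mapQ_mkQ, Submodule.map_comp, hY', map_comap_subtype, inf_eq_right.2 hYZ,
        Submodule.map_span, Set.image_insert_eq, span_insert]
      refine sup_eq_left.2 ?_
      rw [← Submodule.map_span, mkQ_map_self]
      exact bot_le
    rw [← h2]
    exact (LinearEquiv.finrank_eq (Submodule.equivMapOfInjective f hf _))
  refine ⟨?_, ?_, ?_, ?_, ?_⟩
  · intro B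
    unfold ldim
    rw [Set.empty_union]
    have : (span R B).comap (span R B).subtype = ⊤ := by simp
    rw [this]
    exact Module.finrank_zero_of_subsingleton
  · intro z B x hz hx
    rw [key z B x hz]
    have : (span R B).mkQ x = 0 := by simpa using hx
    rw [this]; simp
  · intro z B x hz hx
    rw [key z B x hz]
    have : (span R B).mkQ x ≠ 0 := by simpa using hx
    rw [finrank_span_singleton this]
  · intro B B' h
    exact span_mono h
  · intro B x hx
    obtain ⟨T, hT, hx⟩ := mem_span_finite_of_mem_span hx
    exact ⟨T, T.finite_toSet, hT, hx⟩

theorem ldim_modular {V : Type*} [AddCommGroup V] [Module ℚ V] (S Y : Submodule ℚ V) (hSY : S ≤ Y)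
    (z : Set V) :
    ldim ℚ z ((span ℚ ((S : Set V) ∪ z) ⊓ Y : Submodule ℚ V) : Set V) = ldim ℚ z (Y : Set V) := by
  unfold ldim
  obtain ⟨X, hX⟩ : ∃ X, X = span ℚ ((S : Set V) ∪ z) := ⟨_, rfl⟩
  rw [← hX]
  have hX' : X = S ⊔ span ℚ z := by rw [hX, span_union, span_eq]
  have hSX : S ≤ X := hX' ▸ le_sup_left
  have hzX : span ℚ z ≤ X := hX' ▸ le_sup_right
  have e1 : span ℚ (z ∪ ((X ⊓ Y : Submodule ℚ V) : Set V)) = X := by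
    rw [span_union, span_eq]
    apply le_antisymm
    · exact sup_le hzX inf_le_left
    · have : X ≤ span ℚ z ⊔ S := by rw [hX', sup_comm]
      exact this.trans (sup_le_sup_left (le_inf hSX hSY) _)
  have e2 : span ℚ (z ∪ (Y : Set V)) = X ⊔ Y := by
    rw [span_union, span_eq]
    apply le_antisymm
    · exact sup_le_sup_right hzX _
    · refine sup_le ?_ le_sup_right
      rw [hX']
      exact sup_le (hSY.trans le_sup_right) le_sup_left
  rw [e1, e2, span_eq, span_eq]
  have e := LinearMap.quotientInfEquivSupQuotient X Y
  exact e.finrank_eq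

/-! ### Transcendence degree -/

section TD

variable {F : Type} [Field F] [CharZero F]

theorem td_set_iff {A : Set F} (B : Set F) (n : ℕ) :
    (∃ s : Fin n → F, (∀ i, s i ∈ A) ∧ AlgebraicIndependent (Algebra.adjoin ℚ B) s) ↔
      (n : ℕ∞) ≤ (AlgebraicIndependent.matroid (Algebra.adjoin ℚ B) F).eRk A := by
  rw [Matroid.le_eRk_iff]
  constructor
  · rintro ⟨s, hs, hi⟩
    refine ⟨Set.range s, ?_, hi.to_subtype_range, ?_⟩
    · rintro _ ⟨i, rfl⟩; exact hs i
    · rw [← Set.image_univ, hi.injective.encard_image]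
      simp
  · rintro ⟨I, hIA, hI, hc⟩
    have hfin : I.Finite := Set.finite_of_encard_eq_coe hc
    have : Finite I := hfin
    have hcard : Nat.card I = n := by
      have h1 := hfin.cast_ncard_eq
      rw [hc] at h1
      rw [Nat.card_coe_set_eq]
      exact_mod_cast h1
    let e : Fin n ≃ I := (Finite.equivFinOfCardEq hcard).symm
    refine ⟨fun i => (e i : F), fun i => hIA (e i).2, ?_⟩
    have hI' : AlgebraicIndependent (Algebra.adjoin ℚ B) ((↑) : I → F) := hI
    exact hI'.comp e e.injective

theorem td_eq_eRk {A : Set F} (hA : A.Finite) (B : Set F) :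
    (td A B : ℕ∞) = (AlgebraicIndependent.matroid (Algebra.adjoin ℚ B) F).eRk A := by
  set M := AlgebraicIndependent.matroid (Algebra.adjoin ℚ B) F
  have hne : M.eRk A ≠ ⊤ := by
    intro h
    have := M.eRk_le_encard A
    rw [h, top_le_iff] at this
    exact hA.encard_lt_top.ne this
  obtain ⟨k, hk⟩ := ENat.ne_top_iff_exists.1 hne
  have : td A B = k := by
    unfold td
    have : {n : ℕ | ∃ s : Fin n → F, (∀ i, s i ∈ A) ∧
        AlgebraicIndependent (Algebra.adjoin ℚ B) s} = Set.Iic k := by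
      ext n
      rw [Set.mem_ofPred_eq, td_set_iff, ← hk]
      simp
    rw [this]
    exact csSup_Iic
  rw [this, hk]

theorem algInd_insert_iff {B : Set F} {x : F} {ι : Type*} (y : ι → F) :
    AlgebraicIndependent (Algebra.adjoin (Algebra.adjoin ℚ B) {x}) y ↔
      AlgebraicIndependent (Algebra.adjoin ℚ (insert x B)) y := by
  have h := Algebra.adjoin_union_eq_adjoin_adjoin ℚ B {x}
  rw [Set.union_singleton] at h
  rw [h]
  exact Iff.rfl

theorem algInd_adjoin_iff {R G : Type*} [CommRing R] [Field G] [Algebra R G] [FaithfulSMul R G]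
    {x : G} (hx : IsAlgebraic R x) {ι : Type*} (s : ι → G) :
    AlgebraicIndependent R s ↔ AlgebraicIndependent (Algebra.adjoin R {x}) s := by
  have hR : IsDomain R := (FaithfulSMul.algebraMap_injective R G).isDomain (algebraMap R G)
  have h1 : Algebra.IsAlgebraic R (Algebra.adjoin R {x}) :=
    (Subalgebra.isAlgebraic_iff _).1 (Algebra.isAlgebraic_adjoin_singleton_iff.2 hx)
  have h2 : FaithfulSMul R (Algebra.adjoin R {x}) := by
    rw [faithfulSMul_iff_algebraMap_injective]
    intro a b hab
    exact FaithfulSMul.algebraMap_injective R G (congrArg Subtype.val hab)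
  exact Algebra.IsAlgebraic.algebraicIndependent_iff _ _

theorem td_step0 {A B : Set F} {x : F}
    (hx : IsAlgebraic (Algebra.adjoin ℚ B) x) : td (insert x A) B = td A (insert x B) := by
  have hfin : ∀ (n : ℕ) (s : Fin n → F), AlgebraicIndependent (Algebra.adjoin ℚ B) s ↔
      AlgebraicIndependent (Algebra.adjoin ℚ (insert x B)) s := by
    intro n s
    rw [← algInd_insert_iff]
    exact algInd_adjoin_iff hx s
  unfold td
  congr 1
  ext n
  constructor
  · rintro ⟨s, hs, hi⟩
    refine ⟨s, fun i => ?_, (hfin n s).1 hi⟩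
    rcases hs i with h | h
    · exact absurd (h ▸ hx) (hi.transcendental i)
    · exact h
  · rintro ⟨s, hs, hi⟩
    exact ⟨s, fun i => Or.inr (hs i), (hfin n s).2 hi⟩

theorem matroid_insert_iff {B J : Set F} {x : F} (hxJ : x ∉ J)
    (hx : Transcendental (Algebra.adjoin ℚ B) x) :
    (AlgebraicIndependent.matroid (Algebra.adjoin ℚ B) F).Indep (insert x J) ↔
    (AlgebraicIndependent.matroid (Algebra.adjoin ℚ (insert x B)) F).Indep J := by
  classical
  have h1 : (AlgebraicIndependent.matroid (Algebra.adjoin ℚ B) F).Indep (insert x J) ↔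
      AlgebraicIndependent (Algebra.adjoin ℚ B)
        (Sum.elim (fun j : J => (j : F)) (fun _ : PUnit.{1} => x)) := by
    rw [AlgebraicIndependent.matroid_indep_iff]
    have hc : (fun i : (insert x J : Set F) => (i : F)) ∘ (Equiv.Set.insert hxJ).symm =
        (Sum.elim (fun j : J => (j : F)) (fun _ : PUnit.{1} => x)) := by
      ext (j | j) <;> simp
    exact (algebraicIndependent_equiv' (R := Algebra.adjoin ℚ B) (Equiv.Set.insert hxJ).symm hc).symm
  rw [h1, AlgebraicIndependent.sumElim_iff]
  have h2 : AlgebraicIndependent (Algebra.adjoin ℚ B) (fun _ : PUnit.{1} => x) :=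
    algebraicIndependent_unique_type_iff.2 hx
  have h3 : Set.range (fun _ : PUnit.{1} => x) = {x} := Set.range_const
  rw [h3, algInd_insert_iff]
  exact ⟨fun h => h.2, fun h => ⟨h2, h⟩⟩

theorem td_step1 {A B : Set F} {x : F} (hA : A.Finite)
    (hx : ¬ IsAlgebraic (Algebra.adjoin ℚ B) x) : td (insert x A) B = td A (insert x B) + 1 := by
  have hx' : Transcendental (Algebra.adjoin ℚ B) x := hx
  have key : ((td (insert x A) B : ℕ) : ℕ∞) = ((td A (insert x B) + 1 : ℕ) : ℕ∞) := by
    push_cast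
    rw [td_eq_eRk (hA.insert x), td_eq_eRk hA]
    apply le_antisymm
    · have hi : (AlgebraicIndependent.matroid (Algebra.adjoin ℚ B) F).Indep {x} := by
        rw [AlgebraicIndependent.matroid_indep_iff]
        exact algebraicIndependent_unique_type_iff.2 hx'
      obtain ⟨I, hI, hxI⟩ := hi.subset_isBasis_of_subset
        (Set.singleton_subset_iff.2 (Set.mem_insert x A)) (Set.subset_univ _)
      have hxI' : x ∈ I := hxI rfl
      rw [← hI.encard_eq_eRk, ← Set.encard_sdiff_singleton_add_one hxI']
      gcongr
      apply Matroid.Indep.encard_le_eRk_of_subset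
      · rw [← matroid_insert_iff (by simp) hx', Set.insert_sdiff_singleton, Set.insert_eq_of_mem hxI']
        exact hI.indep
      · rintro y ⟨hy, hyx⟩
        exact (hI.subset hy).resolve_left hyx
    · obtain ⟨J, hJ⟩ := (AlgebraicIndependent.matroid (Algebra.adjoin ℚ (insert x B)) F).exists_isBasis
        A (Set.subset_univ _)
      have hJi : AlgebraicIndependent (Algebra.adjoin ℚ (insert x B)) ((↑) : J → F) := hJ.indep
      have hxJ : x ∉ J := fun h => hJi.transcendental ⟨x, h⟩
        (isAlgebraic_algebraMap
          (⟨x, Algebra.subset_adjoin (Set.mem_insert _ _)⟩ : Algebra.adjoin ℚ (insert x B)))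
      rw [← hJ.encard_eq_eRk, ← Set.encard_insert_of_notMem hxJ]
      exact Matroid.Indep.encard_le_eRk_of_subset ((matroid_insert_iff hxJ hx').2 hJ.indep)
        (Set.insert_subset_insert hJ.subset)
  exact_mod_cast key

theorem mem_matroid_closure {B : Set F} {x : F} :
    x ∈ (AlgebraicIndependent.matroid ℚ F).closure B ↔ IsAlgebraic (Algebra.adjoin ℚ B) x := by
  rw [AlgebraicIndependent.matroid_closure_eq, SetLike.mem_coe]
  exact Iff.rfl

theorem td_isRk {V : Type*} (e : V → F) :
    IsRk (V := V) (fun A B => td (e '' A) (e '' B))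
      (fun B => {x | IsAlgebraic (Algebra.adjoin ℚ (e '' B)) (e x)}) := by
  refine ⟨?_, ?_, ?_, ?_, ?_⟩
  · intro B
    have := td_eq_eRk (F := F) (A := e '' ∅) (by simp) (e '' B)
    simpa using this
  · intro z B x hz hx
    simp only [Set.image_insert_eq]
    exact td_step0 hx
  · intro z B x hz hx
    simp only [Set.image_insert_eq]
    exact td_step1 (hz.image e) hx
  · intro B B' h x hx
    exact mem_matroid_closure.1 (Matroid.closure_subset_closure _ (Set.image_mono h)
      (mem_matroid_closure.2 hx))
  · intro B x hx
    obtain ⟨T, hT, hTf, -, hx⟩ := Matroid.exists_mem_finite_closure_of_mem_closure (mem_matroid_closure.2 hx)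
    obtain ⟨w, hw, rfl⟩ := Set.subset_image_iff.1 hT
    obtain ⟨u, huw, hu⟩ := Set.exists_subset_bijOn w e
    have hu' : e '' u = e '' w := hu.image_eq
    refine ⟨u, ?_, huw.trans hw, ?_⟩
    · exact Set.Finite.of_finite_image (hu' ▸ hTf) hu.injOn
    · show IsAlgebraic (Algebra.adjoin ℚ (e '' u)) (e x)
      rw [hu']; exact mem_matroid_closure.1 hx

end TD

/-! ### Properties of the predimension -/

namespace PPF

variable (P : PPF K)

theorem exp_zero' : P.exp 0 = 1 := by
  have h := P.exp_add 0 P.D.zero_mem 0 P.D.zero_mem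
  rw [add_zero] at h
  exact (mul_eq_left₀ (P.exp_ne_zero 0 P.D.zero_mem)).1 h.symm

theorem exp_nsmul' (n : ℕ) {x : P.V} (hx : x ∈ P.D) : P.exp (n • x) = P.exp x ^ n := by
  induction n with
  | zero => simp [P.exp_zero']
  | succ n ih =>
    rw [succ_nsmul, P.exp_add _ (P.D.nsmul_mem hx n) _ hx, ih, pow_succ]

theorem span_sub_clT {B : Set P.V} (hB : B ⊆ P.D) :
    ((span ℚ B : Submodule ℚ P.V) : Set P.V) ⊆
      {x | IsAlgebraic (Algebra.adjoin ℚ (P.exp '' B)) (P.exp x)} := by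
  intro x hx
  have hsp : span ℚ B ≤ P.D := span_le.2 hB
  have h0 : IsAlgebraic (Algebra.adjoin ℚ (P.exp '' B)) (P.exp 0) := by
    rw [P.exp_zero']; exact isAlgebraic_one
  show IsAlgebraic (Algebra.adjoin ℚ (P.exp '' B)) (P.exp x)
  induction hx using Submodule.span_induction with
  | mem x hx =>
    exact isAlgebraic_algebraMap
      (⟨P.exp x, Algebra.subset_adjoin ⟨x, hx, rfl⟩⟩ : Algebra.adjoin ℚ (P.exp '' B))
  | zero => exact h0
  | add x y hx hy ihx ihy =>
    rw [P.exp_add _ (hsp hx) _ (hsp hy)]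
    exact ihx.mul ihy
  | smul q x hx ih =>
    have hxD := hsp hx
    have hqD : q • x ∈ P.D := P.D.smul_mem q hxD
    apply IsAlgebraic.of_pow (n := q.den) q.den_pos
    rw [← P.exp_nsmul' _ hqD]
    have e : q.den • (q • x) = q.num • x := by
      rw [← Nat.cast_smul_eq_nsmul ℚ, smul_smul, Rat.den_mul_eq_num, Int.cast_smul_eq_zsmul]
    rw [e]
    obtain ⟨n, hn | hn⟩ := q.num.eq_nat_or_neg
    · rw [hn, natCast_zsmul, P.exp_nsmul' _ hxD]
      exact ih.pow n
    · rw [hn, neg_smul, natCast_zsmul]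
      have hnD : n • x ∈ P.D := P.D.nsmul_mem hxD n
      have h1 := P.exp_add _ (P.D.neg_mem hnD) _ hnD
      rw [neg_add_cancel, P.exp_zero', P.exp_nsmul' _ hxD] at h1
      rw [eq_inv_of_mul_eq_one_left h1.symm]
      exact (ih.pow n).inv

theorem span_sub_K (B : Set P.V) :
    ((span ℚ B : Submodule ℚ P.V) : Set P.V) ⊆ (span K B : Set P.V) :=
  span_subset_span ℚ K B

theorem delta_add {z z' : Set P.V} (hz : z.Finite) (hz' : z'.Finite) (B : Set P.V) :
    P.delta (z ∪ z') B = P.delta z' B + P.delta z (B ∪ z') := by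
  have h1 := (ldim_isRk K P.V).add hz hz' B
  have h2 := (td_isRk P.exp).add hz hz' B
  have h3 := (ldim_isRk ℚ P.V).add hz hz' B
  unfold delta
  rw [h1, h2, h3]
  push_cast
  ring

theorem delta_zero {z B : Set P.V} (hz : z.Finite) (hB : B ⊆ P.D)
    (hzB : z ⊆ (span ℚ B : Submodule ℚ P.V)) : P.delta z B = 0 := by
  have h1 := (ldim_isRk K P.V).eq_zero hz (hzB.trans (P.span_sub_K B))
  have h2 := (td_isRk P.exp).eq_zero hz (hzB.trans (P.span_sub_clT hB))
  have h3 := (ldim_isRk ℚ P.V).eq_zero hz hzB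
  unfold delta
  rw [h1, h2, h3]
  simp

theorem delta_congr {z B B' : Set P.V} (hz : z.Finite) (hB : B ⊆ P.D) (hBB : B ⊆ B')
    (hB' : B' ⊆ (span ℚ B : Submodule ℚ P.V)) : P.delta z B' = P.delta z B := by
  have h1 := (ldim_isRk K P.V).congr_base hz hBB (hB'.trans (P.span_sub_K B))
  have h2 := (td_isRk P.exp).congr_base hz hBB (hB'.trans (P.span_sub_clT hB))
  have h3 := (ldim_isRk ℚ P.V).congr_base hz hBB hB'
  unfold delta
  rw [h1, h2, h3]

theorem delta_span {z B : Set P.V} (hz : z.Finite) (hB : B ⊆ P.D) :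
    P.delta z ((span ℚ B : Submodule ℚ P.V) : Set P.V) = P.delta z B :=
  P.delta_congr hz hB subset_span le_rfl

theorem delta_singleton_le (x : P.V) {B : Set P.V} (hB : B ⊆ P.D) : P.delta {x} B ≤ 1 := by
  by_cases hx : x ∈ span ℚ B
  · rw [P.delta_zero (Set.finite_singleton x) hB (Set.singleton_subset_iff.2 hx)]
    norm_num
  · have h1 := (ldim_isRk K P.V).singleton_le x B
    have h2 := (td_isRk P.exp).singleton_le x B
    have h3 := (ldim_isRk ℚ P.V).singleton1 (x := x) (B := B) hx
    unfold delta
    omega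

theorem delta_le_ncard {z : Set P.V} (hz : z.Finite) (hzD : z ⊆ P.D) {B : Set P.V}
    (hB : B ⊆ P.D) : P.delta z B ≤ z.ncard := by
  induction z, hz using Set.Finite.induction_on generalizing B with
  | empty => simp [P.delta_zero Set.finite_empty hB (Set.empty_subset _)]
  | @insert x t hx ht ih =>
    have hxD : x ∈ P.D := hzD (Set.mem_insert _ _)
    have h1 := P.delta_add ht (Set.finite_singleton x) B
    rw [Set.union_singleton] at h1
    have h2 := P.delta_singleton_le x hB
    have h3 := ih ((Set.subset_insert _ _).trans hzD) (B := B ∪ {x})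
      (Set.union_subset hB (Set.singleton_subset_iff.2 hxD))
    rw [Set.ncard_insert_of_notMem hx ht]
    push_cast
    omega

/-- Submodularity of the predimension. -/
theorem delta_submod {S Y : Submodule ℚ P.V} (hSY : S ≤ Y) (hY : Y ≤ P.D) {z : Set P.V}
    (hz : z.Finite) (hzD : z ⊆ P.D) {a : Set P.V} (ha : a.Finite)
    (haX : a ⊆ (span ℚ ((S : Set P.V) ∪ z) : Submodule ℚ P.V)) (haY : a ⊆ Y) :
    ∃ w : Set P.V, w.Finite ∧ a ⊆ w ∧ w ⊆ (span ℚ ((S : Set P.V) ∪ z) : Submodule ℚ P.V) ∧ w ⊆ Y ∧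
      P.delta z Y + P.delta w S ≤ P.delta z S := by
  obtain ⟨w, hw, hwS, hle⟩ := (ldim_isRk ℚ P.V).finchar hz (S : Set P.V)
    ((span ℚ ((S : Set P.V) ∪ z) ⊓ Y : Submodule ℚ P.V) : Set P.V)
  have hSX : (S : Set P.V) ⊆ ((span ℚ ((S : Set P.V) ∪ z) ⊓ Y : Submodule ℚ P.V) : Set P.V) :=
    fun y hy => ⟨subset_span (Or.inl hy), hSY hy⟩
  rw [Set.union_eq_self_of_subset_left hSX, ldim_modular S Y hSY z] at hle
  have hSD : (S : Set P.V) ⊆ P.D := hSY.trans hY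
  have hwa : w ∪ a ⊆ (span ℚ ((S : Set P.V) ∪ z) : Submodule ℚ P.V) :=
    Set.union_subset (fun y hy => (hwS hy).1) haX
  have hwY : w ∪ a ⊆ Y := Set.union_subset (fun y hy => (hwS hy).2) haY
  have hwf := hw.union ha
  refine ⟨w ∪ a, hwf, Set.subset_union_right, hwa, hwY, ?_⟩
  have h1 := P.delta_add hz hwf (S : Set P.V)
  have h2 := P.delta_add hwf hz (S : Set P.V)
  rw [P.delta_zero hwf (Set.union_subset hSD hzD) hwa, Set.union_comm] at h2
  have hsub : (S : Set P.V) ∪ (w ∪ a) ⊆ Y := Set.union_subset hSY hwY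
  have h3 := (ldim_isRk K P.V).anti hz hsub
  have h4 := (td_isRk P.exp).anti hz hsub
  have h5 := (ldim_isRk ℚ P.V).anti hz
    (Set.union_subset_union_right (S : Set P.V) (Set.subset_union_left (s := w) (t := a)))
  have h6 : P.delta z Y ≤ P.delta z ((S : Set P.V) ∪ (w ∪ a)) := by
    unfold delta
    omega
  omega

/-- Finite character of the predimension. -/
theorem delta_finchar {z : Set P.V} (hz : z.Finite) {T S : Set P.V} (hTS : T ⊆ S) :
    ∃ w : Set P.V, w.Finite ∧ w ⊆ S ∧ ∀ w', w ⊆ w' → w' ⊆ S →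
      P.delta z (T ∪ w') ≤ P.delta z S := by
  obtain ⟨w₁, hw₁, hwS₁, hle₁⟩ := (ldim_isRk K P.V).finchar hz T S
  obtain ⟨w₂, hw₂, hwS₂, hle₂⟩ := (td_isRk P.exp).finchar hz T S
  rw [Set.union_eq_self_of_subset_left hTS] at hle₁ hle₂
  refine ⟨w₁ ∪ w₂, hw₁.union hw₂, Set.union_subset hwS₁ hwS₂, fun w' hw' hS => ?_⟩
  have h1 := (ldim_isRk K P.V).anti hz
    (Set.union_subset_union_right T (Set.subset_union_left.trans hw'))
  have h2 := (td_isRk P.exp).anti hz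
    (Set.union_subset_union_right T (Set.subset_union_right.trans hw'))
  have h3 := (ldim_isRk ℚ P.V).anti hz (Set.union_subset hTS hS)
  unfold delta
  omega

/-! ### Strong and closed subspaces, in terms of finite sets -/

/-- `T` is strong in `E`. -/
def Str (E T : Submodule ℚ P.V) : Prop :=
  ∀ z : Set P.V, z.Finite → z ⊆ E → 0 ≤ P.delta z (T : Set P.V)

/-- `S` is closed in `E`. -/
def Clo (E S : Submodule ℚ P.V) : Prop :=
  ∀ z : Set P.V, z.Finite → z ⊆ E → P.delta z (S : Set P.V) ≤ 0 → z ⊆ S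

theorem exists_fin_range {z : Set P.V} (hz : z.Finite) :
    ∃ (n : ℕ) (s : Fin n → P.V), Set.range s = z := by
  obtain ⟨n, f, h⟩ := hz.fin_embedding
  exact ⟨n, f, h⟩

theorem str_iff (E T : Submodule ℚ P.V) : P.Str E T ↔
    ∀ (n : ℕ) (z : Fin n → P.V), (∀ i, z i ∈ E) → 0 ≤ P.delta (Set.range z) (T : Set P.V) := by
  constructor
  · intro h n z hz
    exact h _ (Set.finite_range z) (by rintro _ ⟨i, rfl⟩; exact hz i)
  · intro h z hz hzE
    obtain ⟨n, s, rfl⟩ := P.exists_fin_range hz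
    exact h n s fun i => hzE ⟨i, rfl⟩

theorem clo_iff (E S : Submodule ℚ P.V) : P.Clo E S ↔
    ∀ (n : ℕ) (z : Fin n → P.V), (∀ i, z i ∈ E) →
      P.delta (Set.range z) (S : Set P.V) ≤ 0 → ∀ i, z i ∈ S := by
  constructor
  · intro h n z hz hd i
    exact h _ (Set.finite_range z) (by rintro _ ⟨i, rfl⟩; exact hz i) hd ⟨i, rfl⟩
  · intro h z hz hzE hd
    obtain ⟨n, s, rfl⟩ := P.exists_fin_range hz
    rintro _ ⟨i, rfl⟩
    exact h n s (fun i => hzE ⟨i, rfl⟩) hd i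

theorem mem_pclIn {E : Submodule ℚ P.V} {A : Set P.V} {x : P.V} :
    x ∈ P.pclIn E A ↔ ∀ S : Submodule ℚ P.V, A ⊆ S → S ≤ E → P.Clo E S → x ∈ S := by
  unfold pclIn
  rw [Submodule.mem_sInf]
  constructor
  · intro h S h1 h2 h3
    exact h S ⟨h1, h2, (P.clo_iff E S).1 h3⟩
  · rintro h S ⟨h1, h2, h3⟩
    exact h S h1 h2 ((P.clo_iff E S).2 h3)

/-- Over a strong base, the predimension is decreasing in the base. -/
theorem delta_anti {E T S : Submodule ℚ P.V} (hE : E ≤ P.D) (hT : P.Str E T) (hTS : T ≤ S)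
    (hS : S ≤ E) {z : Set P.V} (hz : z.Finite) (hzE : z ⊆ E) :
    P.delta z (S : Set P.V) ≤ P.delta z (T : Set P.V) := by
  obtain ⟨w, hw, -, -, hwS, hle⟩ := P.delta_submod hTS (hS.trans hE) hz (hzE.trans hE)
    Set.finite_empty (Set.empty_subset _) (Set.empty_subset _)
  have := hT w hw (hwS.trans hS)
  omega

/-- The concrete closure of a strong `T` in `E`. -/
def InCl (E T : Submodule ℚ P.V) (x : P.V) : Prop :=
  ∃ z : Set P.V, z.Finite ∧ z ⊆ E ∧ x ∈ z ∧ P.delta z (T : Set P.V) ≤ 0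

theorem inCl_mem_pcl {E T : Submodule ℚ P.V} (hE : E ≤ P.D) (hT : P.Str E T)
    {x : P.V} (hx : P.InCl E T x) : x ∈ P.pclIn E (T : Set P.V) := by
  obtain ⟨z, hz, hzE, hxz, hd⟩ := hx
  rw [mem_pclIn]
  intro S hTS hSE hS
  exact hS z hz hzE ((P.delta_anti hE hT hTS hSE hz hzE).trans hd) hxz

theorem delta_union_le {E T : Submodule ℚ P.V} (hE : E ≤ P.D) (hTE : T ≤ E) (hT : P.Str E T)
    {z z' : Set P.V} (hz : z.Finite) (hz' : z'.Finite) (hzE : z ⊆ E) (hzE' : z' ⊆ E) :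
    P.delta (z ∪ z') (T : Set P.V) ≤ P.delta z (T : Set P.V) + P.delta z' (T : Set P.V) := by
  rw [P.delta_add hz hz']
  have h1 : (T : Set P.V) ∪ z' ⊆ E := Set.union_subset hTE hzE'
  have h2 := P.delta_anti hE hT (S := span ℚ ((T : Set P.V) ∪ z'))
    (fun y hy => subset_span (Or.inl hy)) (span_le.2 h1) hz hzE
  rw [P.delta_span hz (h1.trans hE)] at h2
  omega

theorem inCl_finite {E T : Submodule ℚ P.V} (hE : E ≤ P.D) (hTE : T ≤ E) (hT : P.Str E T)
    {w : Set P.V} (hw : w.Finite) (h : ∀ x ∈ w, P.InCl E T x) :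
    ∃ z : Set P.V, z.Finite ∧ z ⊆ E ∧ w ⊆ z ∧ P.delta z (T : Set P.V) ≤ 0 := by
  induction w, hw using Set.Finite.induction_on with
  | empty =>
    refine ⟨∅, Set.finite_empty, Set.empty_subset _, Set.empty_subset _, ?_⟩
    rw [P.delta_zero Set.finite_empty (hTE.trans hE) (Set.empty_subset _)]
  | @insert x t hx ht ih =>
    obtain ⟨z, hz, hzE, htz, hd⟩ := ih fun y hy => h y (Or.inr hy)
    obtain ⟨z', hz', hzE', hxz, hd'⟩ := h x (Or.inl rfl)
    refine ⟨z ∪ z', hz.union hz', Set.union_subset hzE hzE', ?_, ?_⟩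
    · exact Set.insert_subset (Or.inr hxz) (htz.trans Set.subset_union_left)
    · have := P.delta_union_le hE hTE hT hz hz' hzE hzE'
      omega

theorem inCl_span {E T : Submodule ℚ P.V} (hE : E ≤ P.D) (hTE : T ≤ E)
    {z : Set P.V} (hz : z.Finite) (hzE : z ⊆ E) (hd : P.delta z (T : Set P.V) ≤ 0)
    {x : P.V} (hx : x ∈ span ℚ ((T : Set P.V) ∪ z)) : P.InCl E T x := by
  have h1 : (T : Set P.V) ∪ z ⊆ E := Set.union_subset hTE hzE
  refine ⟨{x} ∪ z, (Set.finite_singleton x).union hz, ?_, Or.inl rfl, ?_⟩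
  · exact Set.union_subset (Set.singleton_subset_iff.2 (span_le.2 h1 hx)) hzE
  · rw [P.delta_add (Set.finite_singleton x) hz, P.delta_zero (Set.finite_singleton x)
      (h1.trans hE) (Set.singleton_subset_iff.2 hx)]
    omega

/-- The concrete closure as a subspace. -/
theorem exists_inCl_submodule {E T : Submodule ℚ P.V} (hE : E ≤ P.D) (hTE : T ≤ E)
    (hT : P.Str E T) : ∃ S : Submodule ℚ P.V, (∀ x, x ∈ S ↔ P.InCl E T x) ∧ T ≤ S ∧ S ≤ E := by
  have hd0 : P.delta ∅ (T : Set P.V) ≤ 0 := by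
    rw [P.delta_zero Set.finite_empty (hTE.trans hE) (Set.empty_subset _)]
  have hTin : ∀ x ∈ T, P.InCl E T x := fun x hx =>
    P.inCl_span hE hTE Set.finite_empty (Set.empty_subset _) hd0 (subset_span (Or.inl hx))
  refine ⟨{ carrier := {x | P.InCl E T x}, zero_mem' := hTin 0 T.zero_mem,
            add_mem' := ?_, smul_mem' := ?_ }, fun x => Iff.rfl, hTin, ?_⟩
  · intro x y hx hy
    obtain ⟨z, hz, hzE, hxz, hd⟩ := P.inCl_finite hE hTE hT (w := {x, y}) (by simp)
      (by rintro u (rfl | rfl) <;> assumption)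
    exact P.inCl_span hE hTE hz hzE hd (add_mem (subset_span (Or.inr (hxz (by simp))))
      (subset_span (Or.inr (hxz (by simp)))))
  · intro q x hx
    obtain ⟨z, hz, hzE, hxz, hd⟩ := hx
    exact P.inCl_span hE hTE hz hzE hd (smul_mem _ q (subset_span (Or.inr hxz)))
  · rintro x ⟨z, hz, hzE, hxz, hd⟩
    exact hzE hxz

theorem pcl_inCl {E T : Submodule ℚ P.V} (hE : E ≤ P.D) (hTE : T ≤ E) (hT : P.Str E T)
    {x : P.V} (hx : x ∈ P.pclIn E (T : Set P.V)) : P.InCl E T x := by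
  obtain ⟨S, hS, hTS, hSE⟩ := P.exists_inCl_submodule hE hTE hT
  rw [mem_pclIn] at hx
  refine (hS x).1 (hx S hTS hSE ?_)
  intro z hz hzE hd y hy
  obtain ⟨w, hw, hwS, hw'⟩ := P.delta_finchar hz (T := (T : Set P.V)) (S := (S : Set P.V)) hTS
  obtain ⟨u, hu, huE, hwu, hdu⟩ := P.inCl_finite hE hTE hT hw fun x hx => (hS x).1 (hwS hx)
  have huS : u ⊆ S := fun v hv => (hS v).2 ⟨u, hu, huE, hv, hdu⟩
  have h1 := hw' u hwu huS
  refine (hS y).2 ⟨z ∪ u, hz.union hu, Set.union_subset hzE huE, Or.inl hy, ?_⟩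
  rw [P.delta_add hz hu]
  omega

theorem pclIn_mono {E : Submodule ℚ P.V} {A B : Set P.V} (h : A ⊆ P.pclIn E B) :
    P.pclIn E A ≤ P.pclIn E B := by
  intro x hx
  rw [mem_pclIn] at hx ⊢
  intro S hB hSE hS
  exact hx S (fun y hy => P.mem_pclIn.1 (h hy) S hB hSE hS) hSE hS

theorem subset_pclIn (E : Submodule ℚ P.V) (A : Set P.V) : A ⊆ P.pclIn E A := by
  intro x hx
  rw [SetLike.mem_coe, mem_pclIn]
  intro S hA _ _
  exact hA hx

/-- Step IV: a finite set of small predimension is captured by few elements. -/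
theorem exists_small {E : Submodule ℚ P.V} (hE : E ≤ P.D) (m : ℕ) :
    ∀ (T : Submodule ℚ P.V), T ≤ E → P.Str E T → ∀ w : Set P.V, w.Finite → w ⊆ E →
      P.delta w (T : Set P.V) ≤ m → ∃ m' ≤ m, ∃ t : Fin m' → P.V, (∀ i, t i ∈ E) ∧
        w ⊆ P.pclIn E ((T : Set P.V) ∪ Set.range t) := by
  induction m with
  | zero =>
    intro T hTE hT w hw hwE hd
    refine ⟨0, le_rfl, Fin.elim0, fun i => i.elim0, fun x hx => ?_⟩
    have := P.inCl_mem_pcl hE hT ⟨w, hw, hwE, hx, by simpa using hd⟩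
    simpa using this
  | succ m ih =>
    intro T hTE hT w hw hwE hd
    by_cases hall : ∀ x ∈ w, P.InCl E T x
    · refine ⟨0, Nat.zero_le _, Fin.elim0, fun i => i.elim0, fun x hx => ?_⟩
      have := P.inCl_mem_pcl hE hT (hall x hx)
      simpa using this
    · push Not at hall
      obtain ⟨x, hxw, hx⟩ := hall
      have hxE : x ∈ E := hwE hxw
      have h1 : (T : Set P.V) ∪ {x} ⊆ E := Set.union_subset hTE (Set.singleton_subset_iff.2 hxE)
      have hpos : ∀ z : Set P.V, z.Finite → z ⊆ E → x ∈ z → 0 < P.delta z (T : Set P.V) := by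
        intro z hz hzE hxz
        by_contra hcon
        exact hx ⟨z, hz, hzE, hxz, not_lt.1 hcon⟩
      have hx1 := hpos {x} (Set.finite_singleton x) (Set.singleton_subset_iff.2 hxE) rfl
      have hx2 := P.delta_singleton_le x (hTE.trans hE : (T : Set P.V) ⊆ P.D)
      obtain ⟨m', hm', t, htE, hwt⟩ := ih (span ℚ ((T : Set P.V) ∪ {x})) (span_le.2 h1) (by
        intro z hz hzE
        rw [P.delta_span hz (h1.trans hE)]
        have h2 := P.delta_add hz (Set.finite_singleton x) (T : Set P.V)
        have h3 := hpos (z ∪ {x}) (hz.union (Set.finite_singleton x))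
          (Set.union_subset hzE (Set.singleton_subset_iff.2 hxE)) (Or.inr rfl)
        omega) w hw hwE (by
        rw [P.delta_span hw (h1.trans hE)]
        have h2 := P.delta_add hw (Set.finite_singleton x) (T : Set P.V)
        rw [Set.union_eq_self_of_subset_right (Set.singleton_subset_iff.2 hxw)] at h2
        push_cast at hd
        omega)
      refine ⟨m' + 1, by omega, Fin.cons x t, ?_, hwt.trans (P.pclIn_mono ?_)⟩
      · intro i
        refine Fin.cases ?_ (fun j => ?_) i
        · exact hxE
        · simpa using htE j
      · have hsub := P.subset_pclIn E ((T : Set P.V) ∪ Set.range (Fin.cons x t : Fin (m' + 1) → P.V))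
        refine Set.union_subset (span_le.2 (Set.union_subset ?_ ?_)) ?_
        · exact Set.subset_union_left.trans hsub
        · rintro _ rfl
          exact hsub (Or.inr ⟨0, rfl⟩)
        · rintro _ ⟨i, rfl⟩
          exact hsub (Or.inr ⟨i.succ, by simp⟩)

/-- Step I: strong hulls of finite sets. -/
theorem exists_hull {E T : Submodule ℚ P.V} (hE : E ≤ P.D) (hTE : T ≤ E) (hT : P.Str E T)
    {s : Set P.V} (hs : s.Finite) (hsE : s ⊆ E) :
    ∃ u : Set P.V, u.Finite ∧ s ⊆ u ∧ u ⊆ E ∧ P.delta u (T : Set P.V) ≤ s.ncard ∧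
      P.Str E (span ℚ ((T : Set P.V) ∪ u)) := by
  classical
  let p : ℕ → Prop := fun n => ∃ u : Set P.V, u.Finite ∧ s ⊆ u ∧ u ⊆ E ∧
    P.delta u (T : Set P.V) = n
  have hp : ∃ n, p n := by
    refine ⟨(P.delta s (T : Set P.V)).toNat, s, hs, le_rfl, hsE, ?_⟩
    rw [Int.toNat_of_nonneg (hT s hs hsE)]
  obtain ⟨u, hu, hsu, huE, hdu⟩ := Nat.find_spec hp
  have hmin : ∀ v : Set P.V, v.Finite → s ⊆ v → v ⊆ E →
      P.delta u (T : Set P.V) ≤ P.delta v (T : Set P.V) := by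
    intro v hv hsv hvE
    have h0 := hT v hv hvE
    have := Nat.find_min' hp (m := (P.delta v (T : Set P.V)).toNat)
      ⟨v, hv, hsv, hvE, by rw [Int.toNat_of_nonneg h0]⟩
    omega
  refine ⟨u, hu, hsu, huE, ?_, ?_⟩
  · exact (hmin s hs le_rfl hsE).trans (P.delta_le_ncard hs (hsE.trans hE) (hTE.trans hE))
  · intro z hz hzE
    have h1 : (T : Set P.V) ∪ u ⊆ E := Set.union_subset hTE huE
    rw [P.delta_span hz (h1.trans hE)]
    have h2 := P.delta_add hz hu (T : Set P.V)
    have h3 := hmin (z ∪ u) (hz.union hu) (hsu.trans Set.subset_union_right)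
      (Set.union_subset hzE huE)
    omega

/-- The intersection of a closed set of `D₂` with `D₁` is closed in `D₁`. -/
theorem clo_inf {D₁ D₂ S : Submodule ℚ P.V} (h12 : D₁ ≤ D₂) (hD : D₂ ≤ P.D) (hSD : S ≤ D₂)
    (hS : P.Clo D₂ S) : P.Clo D₁ (S ⊓ D₁) := by
  intro z hz hzE hd
  obtain ⟨w, hw, -, hwX, hwS, hle⟩ := P.delta_submod (S := S ⊓ D₁) (Y := S) inf_le_left
    (hSD.trans hD) hz (hzE.trans (h12.trans hD)) Set.finite_empty (Set.empty_subset _)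
    (Set.empty_subset _)
  have hX : span ℚ (((S ⊓ D₁ : Submodule ℚ P.V) : Set P.V) ∪ z) ≤ D₁ :=
    span_le.2 (Set.union_subset (fun y hy => hy.2) hzE)
  have hw0 : P.delta w ((S ⊓ D₁ : Submodule ℚ P.V) : Set P.V) = 0 := by
    apply P.delta_zero hw
    · exact fun y hy => hD (hSD hy.1)
    · intro y hy
      exact subset_span ⟨hwS hy, hX (hwX hy)⟩
  have := hS z hz (hzE.trans h12) (by omega)
  exact fun y hy => ⟨this hy, hzE hy⟩

end PPF

/-- **Strong extensions preserve powers-transcendence degree** (Lemma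
`strong ext preserve ktd`): if D₀ ◁ D₁ ◁ D₂, then for every finite tuple `a` from D₁,
K-td computed in D₁ over D₀ agrees with K-td computed in D₂ over D₀. -/
theorem strongExt_preserves_ktd (P : PPF K) (D₀ D₁ D₂ : Submodule ℚ P.V)
    (h01 : P.StrongExt D₀ D₁) (h12 : P.StrongExt D₁ D₂) :
    ∀ (n : ℕ) (a : Fin n → P.V), (∀ i, a i ∈ D₁) →
      P.ktdIn D₁ (Set.range a) (D₀ : Set P.V) = P.ktdIn D₂ (Set.range a) (D₀ : Set P.V) := by
  intro n a ha
  obtain ⟨le01, hD1, -, hs01⟩ := h01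
  obtain ⟨le12, hD2, -, hs12⟩ := h12
  have str01 : P.Str D₁ D₀ := (P.str_iff D₁ D₀).2 hs01
  have str12 : P.Str D₂ D₁ := (P.str_iff D₂ D₁).2 hs12
  have le02 : D₀ ≤ D₂ := le01.trans le12
  have str02 : P.Str D₂ D₀ := by
    intro z hz hzE
    obtain ⟨w, hw, -, -, hwY, hle⟩ := P.delta_submod le01 hD1 hz (hzE.trans hD2)
      Set.finite_empty (Set.empty_subset _) (Set.empty_subset _)
    have h1 := str12 z hz hzE
    have h2 := str01 w hw hwY
    omega
  have haD : Set.range a ⊆ D₁ := by rintro _ ⟨i, rfl⟩; exact ha i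
  have hne : {m | ∃ s : Fin m → P.V, (∀ i, s i ∈ D₁) ∧
      Set.range a ⊆ P.pclIn D₁ ((D₀ : Set P.V) ∪ Set.range s)}.Nonempty :=
    ⟨n, a, ha, Set.subset_union_right.trans (P.subset_pclIn _ _)⟩
  have hsub : ∀ m, (∃ s : Fin m → P.V, (∀ i, s i ∈ D₁) ∧
      Set.range a ⊆ P.pclIn D₁ ((D₀ : Set P.V) ∪ Set.range s)) →
      (∃ s : Fin m → P.V, (∀ i, s i ∈ D₂) ∧
      Set.range a ⊆ P.pclIn D₂ ((D₀ : Set P.V) ∪ Set.range s)) := by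
    rintro m ⟨s, hs, hcl⟩
    refine ⟨s, fun i => le12 (hs i), fun x hx => ?_⟩
    have hx1 := P.mem_pclIn.1 (hcl hx)
    rw [SetLike.mem_coe, P.mem_pclIn]
    intro S hA hSE hS
    refine (hx1 (S ⊓ D₁) ?_ inf_le_right (P.clo_inf le12 hD2 hSE hS)).1
    refine fun y hy => ⟨hA hy, ?_⟩
    rcases hy with hy | ⟨i, rfl⟩
    · exact le01 hy
    · exact hs i
  have hback : ∀ m, (∃ s : Fin m → P.V, (∀ i, s i ∈ D₂) ∧
      Set.range a ⊆ P.pclIn D₂ ((D₀ : Set P.V) ∪ Set.range s)) →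
      ∃ m' ≤ m, ∃ s : Fin m' → P.V, (∀ i, s i ∈ D₁) ∧
      Set.range a ⊆ P.pclIn D₁ ((D₀ : Set P.V) ∪ Set.range s) := by
    rintro m ⟨s, hs, hcl⟩
    have hsD : Set.range s ⊆ D₂ := by rintro _ ⟨i, rfl⟩; exact hs i
    have hcard : (Set.range s).ncard ≤ m := by
      have := Set.ncard_image_le (f := s) (Set.finite_univ (α := Fin m))
      rw [Set.image_univ, Set.ncard_univ, Nat.card_fin] at this
      exact this
    obtain ⟨u, hu, hsu, huE, hdu, hstr⟩ := P.exists_hull hD2 le02 str02 (Set.finite_range s) hsD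
    have hTu : (D₀ : Set P.V) ∪ u ⊆ D₂ := Set.union_subset le02 huE
    have hcl' : ∀ x ∈ Set.range a, P.InCl D₂ (span ℚ ((D₀ : Set P.V) ∪ u)) x := by
      intro x hx
      apply P.pcl_inCl hD2 (span_le.2 hTu) hstr
      refine P.pclIn_mono ?_ (hcl hx)
      refine Set.Subset.trans ?_ (P.subset_pclIn _ _)
      exact (Set.union_subset_union_right _ hsu).trans subset_span
    obtain ⟨z, hz, hzE, haz, hdz⟩ := P.inCl_finite hD2 (span_le.2 hTu) hstr (Set.finite_range a) hcl'
    rw [P.delta_span hz (hTu.trans hD2)] at hdz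
    have hzu := P.delta_add hz hu (D₀ : Set P.V)
    have hzuE : z ∪ u ⊆ D₂ := Set.union_subset hzE huE
    obtain ⟨w, hw, haw, -, hwY, hle⟩ := P.delta_submod le01 hD1 (hz.union hu) (hzuE.trans hD2)
      (Set.finite_range a)
      (haz.trans (fun y hy => subset_span (Or.inr (Or.inl hy)))) haD
    have h1 := str12 (z ∪ u) (hz.union hu) hzuE
    obtain ⟨m', hm', t, ht, hwt⟩ := P.exists_small hD1 m D₀ le01 str01 w hw hwY (by omega)
    exact ⟨m', hm', t, ht, haw.trans hwt⟩
  unfold PPF.ktdIn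
  apply le_antisymm
  · have hne2 : {m | ∃ s : Fin m → P.V, (∀ i, s i ∈ D₂) ∧
        Set.range a ⊆ P.pclIn D₂ ((D₀ : Set P.V) ∪ Set.range s)}.Nonempty :=
      hne.mono fun m hm => hsub m hm
    obtain ⟨m', hm', h⟩ := hback _ (Nat.sInf_mem hne2)
    exact (Nat.sInf_le h).trans hm'
  · exact Nat.sInf_le (hsub _ (Nat.sInf_mem hne))
end

section
/- Let D₁ be a full K-powered field and let D₂, D₃ be powers-algebraic strong extensions of D₁ (every element of D₂, resp. D₃, is powers-algebraic over D₁). Then the free amalgam D₄ of D₂ and D₃ over D₁ is a powers-algebraic extension of D₁. -/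
open Set Submodule

variable {K : Type} [Field K] [CharZero K]

/-- A tuple of elements of `F` is linearly independent over the subfield `S`. -/
def LinIndepOver {F : Type*} [Field F] (S : Subfield F) {n : ℕ} (y : Fin n → F) : Prop :=
  ∀ c : Fin n → F, (∀ i, c i ∈ S) → ∑ i, c i * y i = 0 → ∀ i, c i = 0

/-- `S` is a powers-algebraic (strong) extension of `D₁` inside `P`: every finite tuple from
`S` extends to a finite tuple from `S` of predimension zero over `D₁`. -/
def PowersAlgebraicOver (P : PPF K) (D₁ S : Submodule ℚ P.V) : Prop :=
  ∀ (n : ℕ) (z : Fin n → P.V), (∀ i, z i ∈ S) →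
    ∃ (m : ℕ) (z' : Fin m → P.V), (∀ i, z' i ∈ S) ∧
      P.delta (Set.range z ∪ Set.range z') (D₁ : Set P.V) = 0

/-! ### Linear dimension -/

theorem ldim_eq_map (R : Type*) [DivisionRing R] {V : Type*} [AddCommGroup V] [Module R V]
    (A B : Set V) :
    ldim R A B = Module.finrank R ↥((span R A).map (span R B).mkQ) := by
  unfold ldim
  have e1 : (span R A).map (span R B).mkQ = (span R (A ∪ B)).map (span R B).mkQ := by
    rw [span_union, Submodule.map_sup]
    have : (span R B).map (span R B).mkQ = ⊥ := by
      rw [eq_bot_iff, Submodule.map_le_iff_le_comap, Submodule.comap_bot, Submodule.ker_mkQ]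
    rw [this, sup_bot_eq]
  rw [e1]
  have e2 : LinearMap.ker ((span R B).mkQ.comp (span R (A ∪ B)).subtype)
      = (span R B).comap (span R (A ∪ B)).subtype := by
    rw [LinearMap.ker_comp, Submodule.ker_mkQ]
  have e3 : LinearMap.range ((span R B).mkQ.comp (span R (A ∪ B)).subtype)
      = (span R (A ∪ B)).map (span R B).mkQ := by
    rw [LinearMap.range_comp, Submodule.range_subtype]
  rw [← e2, ← e3]
  exact LinearEquiv.finrank_eq (LinearMap.quotKerEquivRange _)

theorem ldim_free (R : Type*) [DivisionRing R] {V : Type*} [AddCommGroup V] [Module R V]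
    (A B C W : Set V) (U₂ U₃ : Submodule R V) (hA : A ⊆ U₂) (hB : B ⊆ U₃)
    (hfA : A.Finite) (hfB : B.Finite)
    (hW : W ⊆ U₃) (hint : U₂ ⊓ U₃ ≤ span R W) (hAC : A ∪ B ⊆ C) (hC : C ⊆ span R (A ∪ B)) :
    ldim R C W = ldim R A W + ldim R B W := by
  have hspan : span R C = span R A ⊔ span R B := by
    rw [← span_union]
    exact le_antisymm (span_le.2 hC) (span_mono hAC)
  rw [ldim_eq_map, ldim_eq_map, ldim_eq_map, hspan, Submodule.map_sup]
  have := FiniteDimensional.span_of_finite R hfA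
  have := FiniteDimensional.span_of_finite R hfB
  rw [← Submodule.finrank_sup_add_finrank_inf_eq]
  have hbot : (span R A).map (span R W).mkQ ⊓ (span R B).map (span R W).mkQ = ⊥ := by
    rw [eq_bot_iff]
    rintro _ ⟨⟨u, hu, rfl⟩, ⟨v, hv, huv⟩⟩
    have hu2 : u ∈ U₂ := span_le.2 hA hu
    have hv3 : v ∈ U₃ := span_le.2 hB hv
    have h1 : v - u ∈ span R W := (Submodule.Quotient.eq _).1 huv
    have h2 : v - u ∈ U₃ := span_le.2 hW h1
    have hu3 : u ∈ U₃ := by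
      have := U₃.sub_mem hv3 h2
      simpa using this
    rw [Submodule.mem_bot]
    exact (Submodule.Quotient.mk_eq_zero _).2 (hint ⟨hu2, hu3⟩)
  rw [hbot, finrank_bot, add_zero]

/-! ### Transcendence degree -/

open AlgebraicIndependent in
theorem td_eq_ncard {F : Type*} [Field F] [CharZero F] (A B I : Set F) (hA : A.Finite)
    (hI : (matroid (Algebra.adjoin ℚ B) F).IsBasis I A) : td A B = I.ncard := by
  have hIfin : I.Finite := hA.subset hI.subset
  have hub : ∀ n ∈ {n : ℕ | ∃ s : Fin n → F, (∀ i, s i ∈ A) ∧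
    AlgebraicIndependent (Algebra.adjoin ℚ B) s}, n ≤ I.ncard := by
    rintro n ⟨s, hs, hind⟩
    have hr : (matroid (Algebra.adjoin ℚ B) F).Indep (range s) := by
      rw [matroid_indep_iff]
      exact hind.coe_range
    have h1 := hr.encard_le_eRk_of_subset (range_subset_iff.2 hs)
    rw [← hI.encard_eq_eRk, ← hIfin.cast_ncard_eq, ← (finite_range s).cast_ncard_eq] at h1
    have h2 : (range s).ncard = n := by
      rw [← Nat.card_coe_set_eq, Nat.card_range_of_injective hind.injective, Nat.card_fin]
    rw [h2] at h1
    exact_mod_cast h1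
  apply le_antisymm
  · apply csSup_le' 
    exact hub
  · apply le_csSup ⟨_, hub⟩
    have : Fintype I := hIfin.fintype
    let e : Fin I.ncard ≃ I := (finCongr (by rw [← Nat.card_coe_set_eq])).trans (Finite.equivFin I).symm
    refine ⟨fun i => (e i : F), fun i => hI.subset (e i).2, ?_⟩
    have h := matroid_indep_iff.1 hI.indep
    exact AlgebraicIndependent.comp h e e.injective

theorem algInd_iff_monomials {S F ι : Type*} [CommRing S] [Field F] [Algebra S F] (x : ι → F) :
    AlgebraicIndependent S x ↔
      LinearIndependent S (fun m : ι →₀ ℕ => m.prod fun i k => x i ^ k) := by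
  have h : (fun m : ι →₀ ℕ => m.prod fun i k => x i ^ k)
      = (MvPolynomial.aeval x : MvPolynomial ι S →ₐ[S] F).toLinearMap ∘
        (MvPolynomial.basisMonomials ι S) := by
    funext m
    simp [MvPolynomial.aeval_monomial]
  rw [h, algebraicIndependent_iff_injective_aeval]
  constructor
  · intro hi
    exact (MvPolynomial.basisMonomials ι S).linearIndependent.map' _ (LinearMap.ker_eq_bot.2 hi)
  · intro hl
    let f := (MvPolynomial.aeval x : MvPolynomial ι S →ₐ[S] F).toLinearMap
    refine (injective_iff_map_eq_zero f).2 fun p hp => ?_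
    have h1 : Finsupp.linearCombination S (f ∘ MvPolynomial.basisMonomials ι S)
        ((MvPolynomial.basisMonomials ι S).repr p) = 0 := by
      rw [← Finsupp.apply_linearCombination, Module.Basis.linearCombination_repr, hp]
    have h2 := (linearIndependent_iff.1 hl) _ h1
    simpa using h2

theorem mem_fieldOf_iff (P : PPF K) (D : Submodule ℚ P.V) (y : P.F) :
    y ∈ P.fieldOf D ↔ y ∈ IntermediateField.adjoin ℚ (P.exp '' D) := by
  change _ ↔ y ∈ (IntermediateField.adjoin ℚ (P.exp '' D)).toSubfield
  rw [IntermediateField.adjoin_toSubfield, Subfield.closure_union]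
  have : Subfield.closure (range (algebraMap ℚ P.F)) ≤ P.fieldOf D := by
    rw [Subfield.closure_le]
    rintro _ ⟨q, rfl⟩
    simp only [eq_ratCast]
    exact SubfieldClass.ratCast_mem _ q
  rw [show P.fieldOf D = Subfield.closure (P.exp '' D) from rfl] at *
  rw [sup_eq_right.2 this]

/-- A tuple of elements of a field with pairwise different indices is linearly independent over
`T` as soon as all its finite subtuples are so over a subfield containing `T`. -/
theorem linInd_of_linIndepOver {F T ι : Type*} [Field F] [CommRing T] [Algebra T F]
    (hinj : Function.Injective (algebraMap T F)) (S : Subfield F)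
    (hS : ∀ t, algebraMap T F t ∈ S) (x : ι → F)
    (h : ∀ (n : ℕ) (f : Fin n → ι), Function.Injective f → LinIndepOver S (x ∘ f)) :
    LinearIndependent T x := by
  rw [linearIndependent_iff']
  intro s g hg i hi
  let e := s.equivFin
  have h1 := h s.card (fun j => (e.symm j : ι))
    (Subtype.val_injective.comp e.symm.injective)
    (fun j => algebraMap T F (g (e.symm j))) (fun j => hS _) (by
      rw [← hg, ← Finset.sum_coe_sort s, ← e.symm.sum_comp]
      simp [Algebra.smul_def]) (e ⟨i, hi⟩)
  simp only [Equiv.symm_apply_apply] at h1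
  exact hinj (by rw [h1, map_zero])

theorem LinearIndependent.linIndepOver {F E : Type*} [Field F] [Field E] [Algebra E F] 
    (S : Subfield F) (hS : ∀ y ∈ S, ∃ t, algebraMap E F t = y) {n : ℕ} (x : Fin n → F)
    (h : LinearIndependent E x) : LinIndepOver S x := by
  intro c hc h0 i
  choose t ht using fun i => hS (c i) (hc i)
  rw [Fintype.linearIndependent_iff] at h
  rw [← ht, h t (by simpa [Algebra.smul_def, ht] using h0) i, map_zero]

open IntermediateField.algebraAdjoinAdjoin in
theorem algInd_free (P : PPF K) (D₁ D₂ D₃ : Submodule ℚ P.V)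
    (hLD : ∀ (n : ℕ) (y : Fin n → P.F), (∀ i, y i ∈ P.fieldOf D₂) →
      LinIndepOver (P.fieldOf D₁) y → LinIndepOver (P.fieldOf D₃) y)
    {ι T : Type*} [CommRing T] [Algebra T P.F] 
    (hinj : Function.Injective (algebraMap T P.F))
    (hT : ∀ t, algebraMap T P.F t ∈ P.fieldOf D₃)
    (x : ι → P.F) (hx : ∀ i, x i ∈ P.fieldOf D₂)
    (hind : AlgebraicIndependent (Algebra.adjoin ℚ (P.exp '' D₁)) x) :
    AlgebraicIndependent T x := by
  rw [algInd_iff_monomials] at hind ⊢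
  rw [LinearIndependent.iff_fractionRing _ (IntermediateField.adjoin ℚ (P.exp '' D₁))] at hind
  refine linInd_of_linIndepOver hinj (P.fieldOf D₃) hT _ fun n f hf => hLD _ _ ?_ ?_
  · intro i
    exact Subfield.prod_mem _ fun j _ => Subfield.pow_mem _ (hx _) _
  · refine LinearIndependent.linIndepOver _ ?_ _ (hind.comp f hf)
    intro y hy
    exact ⟨⟨y, (mem_fieldOf_iff P D₁ y).1 hy⟩, rfl⟩

open AlgebraicIndependent in
theorem td_free (P : PPF K) (D₁ D₂ D₃ : Submodule ℚ P.V) (h13 : D₁ ≤ D₃)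
    (hLD : ∀ (n : ℕ) (y : Fin n → P.F), (∀ i, y i ∈ P.fieldOf D₂) →
      LinIndepOver (P.fieldOf D₁) y → LinIndepOver (P.fieldOf D₃) y)
    (A B C : Set P.F) (hfC : C.Finite)
    (hA : A ⊆ P.fieldOf D₂) (hB : B ⊆ P.fieldOf D₃) (hABC : A ∪ B ⊆ C)
    (hC : C ⊆ Subfield.closure (A ∪ B)) :
    td C (P.exp '' D₁) = td A (P.exp '' D₁) + td B (P.exp '' D₁) := by
  set R := Algebra.adjoin ℚ (P.exp '' D₁) with hR
  have hfA : A.Finite := hfC.subset (subset_union_left.trans hABC)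
  have hfB : B.Finite := hfC.subset (subset_union_right.trans hABC)
  obtain ⟨I, hI⟩ := (matroid R P.F).exists_isBasis A
  obtain ⟨J, hJ⟩ := (matroid R P.F).exists_isBasis B
  have hIi := matroid_indep_iff.1 hI.indep
  have hJi := matroid_indep_iff.1 hJ.indep
  have hJ3 : J ⊆ P.fieldOf D₃ := hJ.subset.trans hB
  have hsum : AlgebraicIndependent R (Sum.elim ((↑) : I → P.F) ((↑) : J → P.F)) := by
    refine AlgebraicIndependent.sumElim hJi ?_
    refine algInd_free P D₁ D₂ D₃ hLD Subtype.val_injective ?_ _ (fun i => hA (hI.subset i.2)) hIi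
    rintro ⟨t, ht⟩
    change t ∈ P.fieldOf D₃
    refine Algebra.adjoin_induction (p := fun t _ => t ∈ P.fieldOf D₃) ?_ ?_ ?_ ?_ ht
    · rintro _ ⟨j, rfl⟩
      exact hJ3 j.2
    · rintro ⟨r, hr⟩
      change r ∈ P.fieldOf D₃
      rw [mem_fieldOf_iff]
      exact IntermediateField.algebra_adjoin_le_adjoin _ _
        (Algebra.adjoin_mono (image_mono h13) hr)
    · intro x y _ _ hx hy
      exact add_mem hx hy
    · intro x y _ _ hx hy
      exact mul_mem hx hy
  have hdisj : Disjoint I J := by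
    rw [Set.disjoint_left]
    intro a ha ha'
    have : (Sum.inl ⟨a, ha⟩ : I ⊕ J) = Sum.inr ⟨a, ha'⟩ := hsum.injective rfl
    cases this
  have hIJ : (matroid R P.F).Indep (I ∪ J) := by
    rw [matroid_indep_iff]
    have := hsum.coe_range
    rwa [Sum.elim_range, Subtype.range_coe, Subtype.range_coe] at this
  have hcl : (A ∪ B : Set P.F) ⊆ (matroid R P.F).closure (I ∪ J) := by
    refine union_subset ?_ ?_
    · exact hI.subset_closure.trans ((matroid R P.F).closure_subset_closure subset_union_left)
    · exact hJ.subset_closure.trans ((matroid R P.F).closure_subset_closure subset_union_right)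
  have hbas : (matroid R P.F).IsBasis (I ∪ J) C := by
    refine hIJ.isBasis_of_subset_of_subset_closure
      ((union_subset_union hI.subset hJ.subset).trans hABC) (hC.trans ?_)
    rw [matroid_closure_eq] at hcl ⊢
    intro c hc
    refine Subfield.closure_induction (p := fun c _ =>
      c ∈ Subalgebra.algebraicClosure (Algebra.adjoin R (I ∪ J)) P.F) ?_ ?_ ?_ ?_ ?_ ?_ hc
    · intro x hx
      exact hcl hx
    · exact one_mem _
    · intro x y _ _ hx hy
      exact add_mem hx hy
    · intro x _ hx
      exact neg_mem hx
    · intro x _ hx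
      exact IsAlgebraic.inv hx
    · intro x y _ _ hx hy
      exact mul_mem hx hy
  rw [td_eq_ncard _ _ _ hfA hI, td_eq_ncard _ _ _ hfB hJ, td_eq_ncard _ _ _ hfC hbas,
    ncard_union_eq hdisj (hfA.subset hI.subset) (hfB.subset hJ.subset)]

/-- **Free amalgams of powers-algebraic extensions are powers-algebraic:** if D₂, D₃ are
powers-algebraic strong extensions of the full K-powered field D₁, their free amalgam
(the ambient P) is a powers-algebraic extension of D₁. -/
theorem free_amalgam_powersAlgebraic (P : PPF K) (D₁ D₂ D₃ : Submodule ℚ P.V)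
    (hfull : P.FullSub D₁)
    (h12 : P.StrongExt D₁ D₂) (h13 : P.StrongExt D₁ D₃)
    (halg2 : PowersAlgebraicOver P D₁ D₂) (halg3 : PowersAlgebraicOver P D₁ D₃)
    -- the ambient P is the free amalgam of D₂ and D₃ over D₁:
    (hgen : D₂ ⊔ D₃ = P.D)
    (hVfree : span K (D₂ : Set P.V) ⊓ span K (D₃ : Set P.V) = span K (D₁ : Set P.V))
    (hQfree : D₂ ⊓ D₃ = D₁)
    (hLD : ∀ (n : ℕ) (y : Fin n → P.F), (∀ i, y i ∈ P.fieldOf D₂) →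
      LinIndepOver (P.fieldOf D₁) y → LinIndepOver (P.fieldOf D₃) y) :
    PowersAlgebraicOver P D₁ P.D := by
  have h₁₂ := h12.1
  have h₁₃ := h13.1
  have h2D := h12.2.1
  have h3D := h13.2.1
  intro n z hz
  have hdec : ∀ i, ∃ a ∈ D₂, ∃ b ∈ D₃, a + b = z i := fun i => by
    have := hz i
    rw [← hgen] at this
    exact Submodule.mem_sup.1 this
  choose a ha b hb hab using hdec
  obtain ⟨m₂, a', ha', hδ2⟩ := halg2 n a ha
  obtain ⟨m₃, b', hb', hδ3⟩ := halg3 n b hb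
  set A := range a ∪ range a' with hA
  set B := range b ∪ range b' with hB
  have hfA : A.Finite := (finite_range a).union (finite_range a')
  have hfB : B.Finite := (finite_range b).union (finite_range b')
  have hA2 : A ⊆ D₂ := union_subset (range_subset_iff.2 ha) (range_subset_iff.2 ha')
  have hB3 : B ⊆ D₃ := union_subset (range_subset_iff.2 hb) (range_subset_iff.2 hb')
  obtain ⟨m, z', -, hz'⟩ := (hfA.union hfB).fin_param
  refine ⟨m, z', ?_, ?_⟩
  · intro i
    have hi : z' i ∈ A ∪ B := hz' ▸ mem_range_self i
    rcases hi with hi | hi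
    · exact h2D (hA2 hi)
    · exact h3D (hB3 hi)
  rw [hz']
  have haA : ∀ i, a i ∈ A := fun i => Or.inl (mem_range_self i)
  have hbB : ∀ i, b i ∈ B := fun i => Or.inl (mem_range_self i)
  have hsub : ∀ (R : Type) [DivisionRing R] [Module R P.V],
      range z ∪ (A ∪ B) ⊆ (span R (A ∪ B) : Set P.V) := by
    intro R _ _
    refine union_subset ?_ subset_span
    rintro _ ⟨i, rfl⟩
    rw [← hab]
    exact add_mem (subset_span (Or.inl (haA i))) (subset_span (Or.inr (hbB i)))
  have hK : ldim K (range z ∪ (A ∪ B)) (D₁ : Set P.V) = ldim K A D₁ + ldim K B D₁ :=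
    ldim_free K A B _ _ (span K (D₂ : Set P.V)) (span K (D₃ : Set P.V))
      (hA2.trans subset_span) (hB3.trans subset_span) hfA hfB
      (Set.Subset.trans h₁₃ subset_span) hVfree.le subset_union_right (hsub K)
  have hQ : ldim ℚ (range z ∪ (A ∪ B)) (D₁ : Set P.V) = ldim ℚ A D₁ + ldim ℚ B D₁ :=
    ldim_free ℚ A B _ _ D₂ D₃ hA2 hB3 hfA hfB h₁₃ (by rw [hQfree, span_eq])
      subset_union_right (hsub ℚ)
  have hT : td (P.exp '' (range z ∪ (A ∪ B))) (P.exp '' D₁)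
      = td (P.exp '' A) (P.exp '' D₁) + td (P.exp '' B) (P.exp '' D₁) := by
    refine td_free P D₁ D₂ D₃ h₁₃ hLD _ _ _
      (((finite_range z).union (hfA.union hfB)).image _) ?_ ?_ ?_ ?_
    · exact (image_mono hA2).trans Subfield.subset_closure
    · exact (image_mono hB3).trans Subfield.subset_closure
    · rw [← image_union]
      exact image_mono subset_union_right
    · rw [← image_union, image_union]
      refine union_subset ?_ Subfield.subset_closure
      rintro _ ⟨_, ⟨i, rfl⟩, rfl⟩
      rw [← hab, P.exp_add _ (h2D (ha i)) _ (h3D (hb i))]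
      exact mul_mem (Subfield.subset_closure (mem_image_of_mem _ (Or.inl (haA i))))
        (Subfield.subset_closure (mem_image_of_mem _ (Or.inr (hbB i))))
  unfold PPF.delta at hδ2 hδ3 ⊢
  rw [hK, hQ, hT]
  push_cast
  linarith
end
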